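/- arXiv:1709.06826 — 2 statements merged into one kernel-verified Lean document; each statement's English description precedes it below -/
import Mathlib

section
/- Let char F = 2. If n > 1, the ternary Jordan algebra 𝒱_{f,0,h} is simple; if n = 1 (basis {1,b}), the subspace spanned by 1 + b is a nonzero proper ideal, so 𝒱_{f,0,h} is not simple. -/
/-- Total commutativity of a ternary product: invariance under all permutations
of the three arguments. -/
def TotComm {W : Type*} (p : W → W → W → W) : Prop :=
  ∀ (σ : Equiv.Perm (Fin 3)) (v : Fin 3 → W),
    p (v (σ 0)) (v (σ 1)) (v (σ 2)) = p (v 0) (v 1) (v 2)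

/-- The operator `D_{x,y} = [R_{(x₂,x₃)}, R_{(y₂,y₃)}]`,
i.e. `z ↦ ⟦⟦z,x₂,x₃⟧,y₂,y₃⟧ − ⟦⟦z,y₂,y₃⟧,x₂,x₃⟧`. -/
def Dop {W : Type*} [Sub W] (p : W → W → W → W) (x₂ x₃ y₂ y₃ z : W) : W :=
  p (p z x₂ x₃) y₂ y₃ - p (p z y₂ y₃) x₂ x₃

/-- A map `D` is a derivation of the ternary product `p`. -/
def IsTernaryDer {W : Type*} [Add W] (p : W → W → W → W) (D : W → W) : Prop :=
  ∀ a b c, D (p a b c) = p (D a) b c + p a (D b) c + p a b (D c)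

/-- A ternary algebra is a ternary Jordan algebra if its product is totally
commutative and every operator `D_{x,y}` is a derivation. -/
def IsTernaryJordan {W : Type*} [Add W] [Sub W] (p : W → W → W → W) : Prop :=
  TotComm p ∧ ∀ x₂ x₃ y₂ y₃, IsTernaryDer p (Dop p x₂ x₃ y₂ y₃)

/-- An ideal of a ternary algebra `(W, p)`: a subspace `I` with
`p I W W ⊆ I`, `p W I W ⊆ I` and `p W W I ⊆ I`. -/
def IsTernaryIdeal (F : Type*) {W : Type*} [Field F] [AddCommGroup W] [Module F W]
    (p : W → W → W → W) (I : Submodule F W) : Prop :=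
  (∀ a ∈ I, ∀ b c, p a b c ∈ I) ∧ (∀ b, ∀ a ∈ I, ∀ c, p b a c ∈ I) ∧
    (∀ b c, ∀ a ∈ I, p b c a ∈ I)

/-- A ternary algebra is simple if its product is nonzero and its only ideals
are `0` and the whole algebra. -/
def IsTernarySimple (F : Type*) {W : Type*} [Field F] [AddCommGroup W] [Module F W]
    (p : W → W → W → W) : Prop :=
  (∃ a b c, p a b c ≠ 0) ∧
    ∀ I : Submodule F W, IsTernaryIdeal F p I → I = ⊥ ∨ I = ⊤

/-- The product of the ternary algebra `𝒱_{f,0,h}` on `F × Fⁿ`, where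
`f(u,v) = h(u,v) = ∑ᵢ uᵢvᵢ` are the standard bilinear forms and `g = 0`. -/
def Vf0h (F : Type*) [Field F] (n : ℕ) :
    (F × (Fin n → F)) → (F × (Fin n → F)) → (F × (Fin n → F)) → (F × (Fin n → F)) :=
  fun x y z =>
    (x.1 * y.1 * z.1 + x.1 * (∑ i, y.2 i * z.2 i) + y.1 * (∑ i, x.2 i * z.2 i)
        + z.1 * (∑ i, x.2 i * y.2 i),
      (y.1 * z.1 + ∑ i, y.2 i * z.2 i) • x.2 +
      (x.1 * z.1 + ∑ i, x.2 i * z.2 i) • y.2 +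
      (x.1 * y.1 + ∑ i, x.2 i * y.2 i) • z.2)

/-- The bilinear form `⟨x, y⟩ = x₁y₁ + ∑ᵢ xᵢyᵢ` on `F × Fⁿ`. -/
def stdForm (F : Type*) [Field F] (n : ℕ) :
    (F × (Fin n → F)) →ₗ[F] (F × (Fin n → F)) →ₗ[F] F :=
  LinearMap.mk₂ F (fun x y => x.1 * y.1 + x.2 ⬝ᵥ y.2)
    (fun x x' y => by simp only [Prod.fst_add, Prod.snd_add, add_dotProduct]; ring)
    (fun c x y => by simp only [Prod.smul_fst, Prod.smul_snd, smul_dotProduct, smul_eq_mul]; ring)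
    (fun x y y' => by simp only [Prod.fst_add, Prod.snd_add, dotProduct_add]; ring)
    (fun c x y => by simp only [Prod.smul_fst, Prod.smul_snd, dotProduct_smul, smul_eq_mul]; ring)

section

variable {F : Type*} [Field F] {n : ℕ}

theorem stdForm_apply (x y : F × (Fin n → F)) :
    stdForm F n x y = x.1 * y.1 + ∑ i, x.2 i * y.2 i := rfl

theorem stdForm_comm (x y : F × (Fin n → F)) : stdForm F n x y = stdForm F n y x := by
  simp only [stdForm_apply, mul_comm]

theorem exists_stdForm_eq_one {x : F × (Fin n → F)} (hx : x ≠ 0) :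
    ∃ w, stdForm F n x w = 1 := by
  suffices ∃ w, stdForm F n x w ≠ 0 by
    obtain ⟨w, hw⟩ := this
    exact ⟨(stdForm F n x w)⁻¹ • w, by simp [hw]⟩
  by_contra! h
  refine hx (Prod.ext ?_ (funext fun i => ?_))
  · simpa [stdForm_apply] using h (1, 0)
  · simpa [stdForm_apply, Pi.single_apply] using h (0, Pi.single i 1)

/-- If `n > 1`, any two vectors of `F × Fⁿ` have a common nonzero orthogonal vector. -/
theorem exists_ne_zero_stdForm_eq_zero (hn : 1 < n) (x w : F × (Fin n → F)) :
    ∃ y ≠ 0, stdForm F n x y = 0 ∧ stdForm F n w y = 0 := by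
  have hker := LinearMap.ker_ne_bot_of_finrank_lt
    (f := (stdForm F n x).prod (stdForm F n w)) (by simp; omega)
  obtain ⟨y, hy, hy0⟩ := Submodule.exists_mem_ne_zero_of_ne_bot hker
  rw [LinearMap.mem_ker, LinearMap.prod_apply, Prod.ext_iff] at hy
  exact ⟨y, hy0, hy⟩

theorem Vf0h_eq_of_charP_two [CharP F 2] (x y z : F × (Fin n → F)) :
    Vf0h F n x y z =
      stdForm F n y z • x + stdForm F n x z • y + stdForm F n x y • z := by
  refine Prod.ext ?_ ?_
  · simp only [Vf0h, stdForm_apply, Prod.fst_add, Prod.smul_fst, smul_eq_mul]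
    linear_combination -(x.1 * y.1 * z.1) * CharTwo.two_eq_zero (R := F)
  · simp only [Vf0h, stdForm_apply, Prod.snd_add, Prod.smul_snd]

theorem isTernaryIdeal_Vf0h_iff [CharP F 2] (I : Submodule F (F × (Fin n → F))) :
    IsTernaryIdeal F (Vf0h F n) I ↔
      ∀ x ∈ I, ∀ y z, stdForm F n x z • y + stdForm F n x y • z ∈ I := by
  have key (x) (hx : x ∈ I) (y z) :
      Vf0h F n x y z ∈ I ↔ stdForm F n x z • y + stdForm F n x y • z ∈ I := by
    rw [Vf0h_eq_of_charP_two, add_assoc, I.add_mem_iff_right (I.smul_mem _ hx)]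
  have swap (x y z) : Vf0h F n y x z = Vf0h F n x y z := by
    rw [Vf0h_eq_of_charP_two, Vf0h_eq_of_charP_two, stdForm_comm y x]
    abel
  have rotate (x y z) : Vf0h F n y z x = Vf0h F n x y z := by
    rw [Vf0h_eq_of_charP_two, Vf0h_eq_of_charP_two, stdForm_comm y x, stdForm_comm z x]
    abel
  refine ⟨fun h x hx y z => (key x hx y z).1 (h.1 x hx y z), fun h => ?_⟩
  have h' (x) (hx : x ∈ I) (y z) : Vf0h F n x y z ∈ I := (key x hx y z).2 (h x hx y z)
  exact ⟨h', fun y x hx z => swap x y z ▸ h' x hx y z, fun y z x hx => rotate x y z ▸ h' x hx y z⟩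

theorem IsTernaryIdeal.mem_of_stdForm_eq_zero [CharP F 2] {I : Submodule F (F × (Fin n → F))}
    (hI : IsTernaryIdeal F (Vf0h F n) I) {x z : F × (Fin n → F)} (hx : x ∈ I) (hx0 : x ≠ 0)
    (hxz : stdForm F n x z = 0) : z ∈ I := by
  obtain ⟨w, hw⟩ := exists_stdForm_eq_one hx0
  simpa [hxz, hw] using (isTernaryIdeal_Vf0h_iff I).1 hI x hx w z

theorem isTernarySimple_Vf0h [CharP F 2] (hn : 1 < n) : IsTernarySimple F (Vf0h F n) := by
  refine ⟨⟨(1, 0), (1, 0), (1, 0), fun h => ?_⟩, fun I hI => ?_⟩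
  · simpa [Vf0h] using congrArg Prod.fst h
  · refine or_iff_not_imp_left.2 fun hbot => (Submodule.eq_top_iff' (p := I)).2 fun w => ?_
    obtain ⟨x, hx, hx0⟩ := Submodule.exists_mem_ne_zero_of_ne_bot hbot
    obtain ⟨y, hy0, hxy, hwy⟩ := exists_ne_zero_stdForm_eq_zero hn x w
    exact hI.mem_of_stdForm_eq_zero (hI.mem_of_stdForm_eq_zero hx hx0 hxy) hy0
      (stdForm_comm w y ▸ hwy)

theorem isTernaryIdeal_span_one_one [CharP F 2] :
    IsTernaryIdeal F (Vf0h F 1)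
      (Submodule.span F {(((1 : F), fun _ => (1 : F)) : F × (Fin 1 → F))}) := by
  rw [isTernaryIdeal_Vf0h_iff]
  intro x hx y z
  obtain ⟨c, rfl⟩ := Submodule.mem_span_singleton.1 hx
  refine Submodule.mem_span_singleton.2 ⟨c * (y.1 * z.2 0 + z.1 * y.2 0), ?_⟩
  refine Prod.ext ?_ (funext fun i => ?_)
  · simp only [stdForm_apply, Prod.smul_mk, Prod.fst_add, Prod.smul_fst, Pi.smul_apply,
      smul_eq_mul, Fin.sum_univ_one]
    linear_combination -(c * y.1 * z.1) * CharTwo.two_eq_zero (R := F)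
  · rw [Subsingleton.elim i 0]
    simp only [stdForm_apply, Prod.smul_mk, Prod.snd_add, Prod.smul_snd, Pi.add_apply,
      Pi.smul_apply, smul_eq_mul, Fin.sum_univ_one]
    linear_combination -(c * y.2 0 * z.2 0) * CharTwo.two_eq_zero (R := F)

theorem span_one_one_ne_bot :
    Submodule.span F {(((1 : F), fun _ => (1 : F)) : F × (Fin 1 → F))} ≠ ⊥ := by
  simp [Prod.ext_iff]

theorem span_one_one_ne_top :
    Submodule.span F {(((1 : F), fun _ => (1 : F)) : F × (Fin 1 → F))} ≠ ⊤ := by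
  intro h
  obtain ⟨c, hc⟩ := Submodule.mem_span_singleton.1
    (h ▸ Submodule.mem_top : ((1, 0) : F × (Fin 1 → F)) ∈ _)
  have h₁ : c = 1 := by simpa using congrArg Prod.fst hc
  have h₂ : c = 0 := by simpa using congrFun (congrArg Prod.snd hc) 0
  exact one_ne_zero (h₁.symm.trans h₂)

end

/-- Over a field of characteristic 2: if `n > 1` the ternary Jordan algebra
`𝒱_{f,0,h}` is simple; if `n = 1` (basis `{1, b}`) the subspace spanned by
`1 + b` is a nonzero proper ideal, so `𝒱_{f,0,h}` is not simple. -/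
theorem Vf0h_simple_iff_of_char_two (F : Type*) [Field F] (hF : ringChar F = 2) (n : ℕ) :
    (1 < n → IsTernarySimple F (Vf0h F n)) ∧
    (IsTernaryIdeal F (Vf0h F 1)
        (Submodule.span F {(((1 : F), fun _ => (1 : F)) : F × (Fin 1 → F))}) ∧
      Submodule.span F {(((1 : F), fun _ => (1 : F)) : F × (Fin 1 → F))} ≠ ⊥ ∧
      Submodule.span F {(((1 : F), fun _ => (1 : F)) : F × (Fin 1 → F))} ≠ ⊤ ∧
      ¬ IsTernarySimple F (Vf0h F 1)) := by
  have : CharP F 2 := ringChar.of_eq hF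
  exact ⟨isTernarySimple_Vf0h, isTernaryIdeal_span_one_one, span_one_one_ne_bot,
    span_one_one_ne_top, fun h => (h.2 _ isTernaryIdeal_span_one_one).elim
      span_one_one_ne_bot span_one_one_ne_top⟩
end

section
/- Let F be a field of characteristic 0 and n ≥ 1. Every derivation of the ternary Jordan algebra 𝔸 is inner: Der(𝔸) equals the linear span of the operators D_{x,y} = [R_{(x₂,x₃)}, R_{(y₂,y₃)}] with x₂,x₃,y₂,y₃ ∈ Fⁿ; in particular, for pairwise different i,j,k, D_{(bᵢ,b_j),(bᵢ,b_k)}(z) = (z,b_j)b_k − (z,b_k)b_j, and for i ≠ j, D_{(bᵢ,bᵢ),(bᵢ,b_j)}(z) = 2((z,bᵢ)b_j − (z,b_j)bᵢ), where b₁,…,bₙ is the standard basis. -/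
/-- The ternary algebra `𝔸` on `V = Fⁿ`: with `(x,y) = ∑ᵢ xᵢyᵢ` the standard
symmetric bilinear form, `⟦x,y,z⟧ = (y,z)x + (x,z)y + (x,y)z`. -/
def tpA (F : Type*) [Field F] (n : ℕ) :
    (Fin n → F) → (Fin n → F) → (Fin n → F) → (Fin n → F) :=
  fun x y z => (∑ i, y i * z i) • x + (∑ i, x i * z i) • y + (∑ i, x i * y i) • z

/-- The linear functional `z ↦ ∑ᵢ wᵢzᵢ` on `Fⁿ`. -/
noncomputable def dotL (F : Type*) [Field F] (n : ℕ) (w : Fin n → F) :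
    (Fin n → F) →ₗ[F] F :=
  ∑ i, w i • LinearMap.proj i

/-- The right multiplication operator `R_{(x₂,x₃)} : z ↦ ⟦z,x₂,x₃⟧` of `𝔸`,
as a linear endomorphism of `Fⁿ`. -/
noncomputable def RlinA (F : Type*) [Field F] (n : ℕ) (x₂ x₃ : Fin n → F) :
    Module.End F (Fin n → F) :=
  (∑ i, x₂ i * x₃ i) • LinearMap.id
    + (dotL F n x₃).smulRight x₂ + (dotL F n x₂).smulRight x₃

section

open scoped Matrix

variable {F : Type*} [Field F] {n : ℕ}

theorem tpA_eq_dotProduct (x y z : Fin n → F) :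
    tpA F n x y z = (y ⬝ᵥ z) • x + (x ⬝ᵥ z) • y + (x ⬝ᵥ y) • z := rfl

theorem RlinA_apply (x₂ x₃ z : Fin n → F) : RlinA F n x₂ x₃ z = tpA F n z x₂ x₃ := by
  have h (w : Fin n → F) : dotL F n w z = z ⬝ᵥ w := by
    simp [dotL, dotProduct, mul_comm]
  rw [tpA_eq_dotProduct]
  simp [RlinA, h, dotProduct]

/-- Right multiplications of `𝔸` are self-adjoint. -/
theorem tpA_dotProduct_comm (x₂ x₃ z w : Fin n → F) :
    tpA F n z x₂ x₃ ⬝ᵥ w = z ⬝ᵥ tpA F n w x₂ x₃ := by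
  simp only [tpA_eq_dotProduct, add_dotProduct, smul_dotProduct, dotProduct_add,
    dotProduct_smul, smul_eq_mul, dotProduct_comm w]
  rw [dotProduct_comm x₂ w, dotProduct_comm x₃ w]
  ring

/-- The derivations of `𝔸` are the endomorphisms that are skew for the standard form. -/
theorem isTernaryDer_tpA_iff [CharZero F] (D : Module.End F (Fin n → F)) :
    IsTernaryDer (tpA F n) D ↔ ∀ x y, D x ⬝ᵥ y + x ⬝ᵥ D y = 0 := by
  constructor
  · intro h
    have isotropic (a : Fin n → F) : a ⬝ᵥ D a = 0 := by
      have h3 := h a a a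
      simp only [tpA_eq_dotProduct, map_add, map_smul, dotProduct_comm (D a) a] at h3
      have h6 : (6 * (a ⬝ᵥ D a)) • a = 0 := by
        rw [← sub_eq_zero.mpr h3.symm]
        module
      rcases smul_eq_zero.mp h6 with h0 | h0
      · simpa using h0
      · simp [h0]
    intro x y
    have hxy := isotropic (x + y)
    simp only [map_add, add_dotProduct, dotProduct_add, isotropic] at hxy
    rw [dotProduct_comm (D x) y]
    linear_combination hxy
  · intro h a b c
    have skew (x y : Fin n → F) : D x ⬝ᵥ y = -(x ⬝ᵥ D y) := eq_neg_of_add_eq_zero_left (h x y)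
    simp only [tpA_eq_dotProduct, map_add, map_smul, skew]
    module

theorem Dop_tpA_single_of_ne {i j k : Fin n} (hij : i ≠ j) (hjk : j ≠ k) (hik : i ≠ k)
    (z : Fin n → F) :
    Dop (tpA F n) (Pi.single i 1) (Pi.single j 1) (Pi.single i 1) (Pi.single k 1) z =
      z j • (Pi.single k 1 : Fin n → F) - z k • (Pi.single j 1 : Fin n → F) := by
  simp [Dop, tpA_eq_dotProduct, hij, hjk, hik, hij.symm, hjk.symm, hik.symm]

theorem Dop_tpA_single_self (i j : Fin n) (z : Fin n → F) :
    Dop (tpA F n) (Pi.single i 1) (Pi.single i 1) (Pi.single i 1) (Pi.single j 1) z =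
      (2 : F) • (z i • (Pi.single j 1 : Fin n → F) - z j • (Pi.single i 1 : Fin n → F)) := by
  obtain rfl | hij := eq_or_ne i j
  · simp [Dop]
  · simp only [Dop, tpA_eq_dotProduct, dotProduct_single, Pi.single_eq_same, Pi.add_apply,
      Pi.smul_apply, Pi.single_eq_of_ne hij, Pi.single_eq_of_ne hij.symm, smul_eq_mul, mul_one]
    module

theorem commutator_RlinA_apply (x₂ x₃ y₂ y₃ z : Fin n → F) :
    (RlinA F n y₂ y₃ * RlinA F n x₂ x₃ - RlinA F n x₂ x₃ * RlinA F n y₂ y₃) z =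
      Dop (tpA F n) x₂ x₃ y₂ y₃ z := by
  simp [Dop, RlinA_apply]

/-- A skew endomorphism is an explicit combination of the operators
`D_{(bᵢ,bᵢ),(bᵢ,bⱼ)}`. -/
theorem eq_sum_commutator_of_skew [CharZero F] (D : Module.End F (Fin n → F))
    (hD : ∀ x y, D x ⬝ᵥ y + x ⬝ᵥ D y = 0) :
    D = ∑ i, ∑ j, (D (Pi.single i 1) j / 4) •
      (RlinA F n (Pi.single i 1) (Pi.single j 1) * RlinA F n (Pi.single i 1) (Pi.single i 1) -
        RlinA F n (Pi.single i 1) (Pi.single i 1) * RlinA F n (Pi.single i 1) (Pi.single j 1)) := by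
  have skew (i j : Fin n) : D (Pi.single i 1) j = -D (Pi.single j 1) i := by
    have h := hD (Pi.single i 1) (Pi.single j 1)
    simp only [dotProduct_single, single_dotProduct, mul_one, one_mul] at h
    exact eq_neg_of_add_eq_zero_left h
  refine LinearMap.pi_ext' fun k => LinearMap.ext_ring (funext fun l => ?_)
  simp only [LinearMap.comp_apply, LinearMap.single_apply, LinearMap.sum_apply,
    LinearMap.smul_apply, commutator_RlinA_apply, Dop_tpA_single_self, Finset.sum_apply,
    Pi.smul_apply, Pi.sub_apply, smul_eq_mul, Pi.single_apply, mul_sub, Finset.sum_sub_distrib,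
    mul_ite, mul_one, mul_zero, Finset.sum_ite_eq,
    Finset.sum_ite_eq', Finset.mem_univ, if_true]
  simp [Finset.sum_ite_eq, skew l k]
  ring

theorem isTernaryDer_tpA_iff_mem_span [CharZero F] (D : Module.End F (Fin n → F)) :
    IsTernaryDer (tpA F n) D ↔ D ∈ Submodule.span F
      {D : Module.End F (Fin n → F) | ∃ x₂ x₃ y₂ y₃ : Fin n → F,
        D = RlinA F n y₂ y₃ * RlinA F n x₂ x₃ - RlinA F n x₂ x₃ * RlinA F n y₂ y₃} := by
  rw [isTernaryDer_tpA_iff]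
  constructor
  · intro h
    rw [eq_sum_commutator_of_skew D h]
    exact Submodule.sum_mem _ fun i _ => Submodule.sum_mem _ fun j _ =>
      Submodule.smul_mem _ _ (Submodule.subset_span ⟨_, _, _, _, rfl⟩)
  · intro h
    induction h using Submodule.span_induction with
    | mem D hD =>
      obtain ⟨x₂, x₃, y₂, y₃, rfl⟩ := hD
      intro x y
      simp only [commutator_RlinA_apply, Dop, sub_dotProduct, dotProduct_sub, tpA_dotProduct_comm]
      ring
    | zero => simp
    | add D E _ _ hD hE =>
      intro x y
      simp only [LinearMap.add_apply, add_dotProduct, dotProduct_add]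
      linear_combination hD x y + hE x y
    | smul c D _ hD =>
      intro x y
      simp only [LinearMap.smul_apply, smul_dotProduct, dotProduct_smul, smul_eq_mul]
      linear_combination c * hD x y

end

/-- For `char F = 0`: every derivation of `𝔸` is inner — the set of
derivations of `𝔸` equals the linear span of the operators
`D_{x,y} = [R_{(x₂,x₃)},R_{(y₂,y₃)}]`; in particular, for pairwise different
`i,j,k`, `D_{(bᵢ,bⱼ),(bᵢ,b_k)}(z) = (z,bⱼ)b_k − (z,b_k)bⱼ`, and for `i ≠ j`,
`D_{(bᵢ,bᵢ),(bᵢ,bⱼ)}(z) = 2((z,bᵢ)bⱼ − (z,bⱼ)bᵢ)`. -/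
theorem tpA_der_eq_inner (F : Type*) [Field F] [CharZero F] (n : ℕ) (hn : 1 ≤ n) :
    (∀ x₂ x₃ z : Fin n → F, RlinA F n x₂ x₃ z = tpA F n z x₂ x₃) ∧
    {D : Module.End F (Fin n → F) | IsTernaryDer (tpA F n) ⇑D} =
      ↑(Submodule.span F
        {D : Module.End F (Fin n → F) | ∃ x₂ x₃ y₂ y₃ : Fin n → F,
          D = RlinA F n y₂ y₃ * RlinA F n x₂ x₃ - RlinA F n x₂ x₃ * RlinA F n y₂ y₃}) ∧
    (∀ i j k : Fin n, i ≠ j → j ≠ k → i ≠ k → ∀ z : Fin n → F,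
      Dop (tpA F n) (Pi.single i 1) (Pi.single j 1) (Pi.single i 1) (Pi.single k 1) z =
        z j • (Pi.single k 1 : Fin n → F) - z k • (Pi.single j 1 : Fin n → F)) ∧
    (∀ i j : Fin n, i ≠ j → ∀ z : Fin n → F,
      Dop (tpA F n) (Pi.single i 1) (Pi.single i 1) (Pi.single i 1) (Pi.single j 1) z =
        (2 : F) • (z i • (Pi.single j 1 : Fin n → F) - z j • (Pi.single i 1 : Fin n → F))) := by
  exact ⟨RlinA_apply, Set.ext isTernaryDer_tpA_iff_mem_span,
    fun _ _ _ hij hjk hik => Dop_tpA_single_of_ne hij hjk hik,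
    fun i j _ => Dop_tpA_single_self i j⟩
end
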